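/- Convolution semigroup property: K(·,·,s) * K(·,·,t) = K(·,·,s+t) for all s,t > 0, where * denotes convolution on ℝ² (with the normalization that the Fourier transform of the convolution equals (2π)² times the product of Fourier transforms). -/

import Mathlib

open MeasureTheory Real Filter Topology

noncomputable def Ksym (ν t : ℝ) (k : ℝ × ℝ) : ℝ :=
  Real.exp (-(t/2) * (k.1^2 / ((1-ν) * Real.sqrt (k.1^2 + k.2^2)) +
    k.2^2 / Real.sqrt (k.1^2 + k.2^2)))

noncomputable def Kdis (ν x y t : ℝ) : ℂ :=
  (1/(2*Real.pi)^2 : ℂ) *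
    ∫ k : ℝ × ℝ, (Ksym ν t k : ℂ) * Complex.exp (Complex.I * ((k.1*x + k.2*y : ℝ) : ℂ))

open scoped FourierTransform ComplexInnerProductSpace ContDiff ComplexConjugate

section Plancherel

variable {E : Type*} [NormedAddCommGroup E] [InnerProductSpace ℝ E] [FiniteDimensional ℝ E]
  [MeasurableSpace E] [BorelSpace E]

theorem continuous_fourier_of_integrable {f : E → ℂ} (hf : Integrable f) : Continuous (𝓕 f) :=
  VectorFourier.fourierIntegral_continuous Real.continuous_fourierChar continuous_inner hf

/-- The `L²` Fourier transform agrees with the integral one on `L¹ ∩ L²`. -/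
theorem coeFn_fourier_toLp {f : E → ℂ} (hf : Integrable f) (hf2 : MemLp f 2) :
    (𝓕 (hf2.toLp f) : Lp (α := E) ℂ 2) =ᵐ[volume] 𝓕 f := by
  apply ae_eq_of_integral_contDiff_smul_eq
  · exact (Lp.memLp _).locallyIntegrable (by norm_num)
  · exact (continuous_fourier_of_integrable hf).locallyIntegrable
  intro g g_smooth g_cpt
  have hg₁ : HasCompactSupport (Complex.ofRealCLM ∘ g) := g_cpt.comp_left rfl
  have hg₂ : ContDiff ℝ ∞ (Complex.ofRealCLM ∘ g) := by fun_prop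
  set φ : SchwartzMap E ℂ := hg₁.toSchwartzMap hg₂
  have hφg : ∀ x, φ x = (g x : ℂ) := fun x => rfl
  have h := DFunLike.congr_fun
    (Lp.fourier_toTemperedDistribution_eq (hf2.toLp f)) φ
  simp only [TemperedDistribution.fourier_apply, Lp.toTemperedDistribution_apply] at h
  calc
    _ = ∫ x, φ x • (𝓕 (hf2.toLp f) : Lp (α := E) ℂ 2 volume) x := by simp [hφg]
    _ = ∫ x, (𝓕 φ) x • (hf2.toLp f) x := h.symm
    _ = ∫ x, (𝓕 (φ : E → ℂ)) x • f x := by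
      apply integral_congr_ae
      filter_upwards [hf2.coeFn_toLp] with x hx
      rw [hx, SchwartzMap.fourier_coe]
    _ = ∫ x, φ x • 𝓕 f x := by
      simpa using! (VectorFourier.integral_fourierIntegral_smul_eq_flip (L := innerₗ E)
        Real.continuous_fourierChar continuous_inner (φ.integrable (μ := volume)) hf)
    _ = _ := by simp [hφg]

/-- Plancherel's theorem for integral Fourier transforms of functions in `L¹ ∩ L²`. -/
theorem integral_conj_fourier_mul_fourier {f g : E → ℂ} (hf : Integrable f) (hf2 : MemLp f 2)
    (hg : Integrable g) (hg2 : MemLp g 2) :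
    ∫ w, conj (𝓕 f w) * 𝓕 g w = ∫ v, conj (f v) * g v := by
  have h := Lp.inner_fourier_eq (hf2.toLp f) (hg2.toLp g)
  rw [L2.inner_def, L2.inner_def] at h
  calc
    _ = _ := integral_congr_ae ?_
    _ = _ := h
    _ = _ := integral_congr_ae ?_
  · filter_upwards [coeFn_fourier_toLp hf hf2, coeFn_fourier_toLp hg hg2] with x h1 h2
    rw [h1, h2, RCLike.inner_apply, mul_comm]
  · filter_upwards [hf2.coeFn_toLp, hg2.coeFn_toLp] with x h1 h2
    rw [h1, h2, RCLike.inner_apply, mul_comm]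

end Plancherel

theorem Ksym_pos (ν t : ℝ) (k : ℝ × ℝ) : 0 < Ksym ν t k := Real.exp_pos _

theorem Ksym_mul (ν s t : ℝ) (k : ℝ × ℝ) : Ksym ν s k * Ksym ν t k = Ksym ν (s + t) k := by
  rw [Ksym, Ksym, Ksym, ← Real.exp_add]
  ring_nf

theorem measurable_Ksym (ν t : ℝ) : Measurable (Ksym ν t) := by
  unfold Ksym
  fun_prop

theorem Ksym_le_exp_neg_norm {ν t : ℝ} (hν0 : 0 ≤ ν) (hν1 : ν < 1) (ht : 0 < t) (k : ℝ × ℝ) :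
    Ksym ν t k ≤ Real.exp (-(t / 2) * ‖k‖) := by
  have hr : ‖k‖ ≤ √(k.1 ^ 2 + k.2 ^ 2) := by
    rw [Prod.norm_def]
    apply max_le <;> apply Real.abs_le_sqrt <;> nlinarith [sq_nonneg k.1, sq_nonneg k.2]
  have hφ : √(k.1 ^ 2 + k.2 ^ 2) ≤ k.1 ^ 2 / ((1 - ν) * √(k.1 ^ 2 + k.2 ^ 2)) +
      k.2 ^ 2 / √(k.1 ^ 2 + k.2 ^ 2) := by
    rcases (Real.sqrt_nonneg (k.1 ^ 2 + k.2 ^ 2)).eq_or_lt with h | h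
    · simp [← h]
    have h1 : k.1 ^ 2 / √(k.1 ^ 2 + k.2 ^ 2) ≤ k.1 ^ 2 / ((1 - ν) * √(k.1 ^ 2 + k.2 ^ 2)) := by
      have : 0 < 1 - ν := by linarith
      apply div_le_div_of_nonneg_left (sq_nonneg _) (by positivity)
      nlinarith
    calc
      √(k.1 ^ 2 + k.2 ^ 2) = k.1 ^ 2 / √(k.1 ^ 2 + k.2 ^ 2) + k.2 ^ 2 / √(k.1 ^ 2 + k.2 ^ 2) := by
        rw [← add_div, Real.div_sqrt]
      _ ≤ _ := by linarith
  apply Real.exp_le_exp.2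
  nlinarith

theorem exp_neg_mul_le {a r : ℝ} (ha : 0 < a) (hr : 0 ≤ r) :
    Real.exp (-a * r) ≤ Real.exp a * 6 / a ^ 3 * (1 + r) ^ (-3 : ℝ) := by
  have h := Real.pow_div_factorial_le_exp (a * (1 + r)) (by positivity) 3
  have h6 : ((Nat.factorial 3 : ℕ) : ℝ) = 6 := by norm_num [Nat.factorial]
  rw [h6, mul_add, mul_one, Real.exp_add] at h
  rw [Real.rpow_neg (by positivity), show (3 : ℝ) = ((3 : ℕ) : ℝ) by norm_num, Real.rpow_natCast,
    neg_mul, Real.exp_neg, ← div_eq_mul_inv, div_div, le_div_iff₀ (by positivity),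
    inv_mul_le_iff₀ (by positivity)]
  rw [div_le_iff₀ (by positivity)] at h
  calc
    a ^ 3 * (1 + r) ^ 3 = (a + a * r) ^ 3 := by ring
    _ ≤ _ := h
    _ = _ := by ring

theorem integrable_Ksym {ν t : ℝ} (hν0 : 0 ≤ ν) (hν1 : ν < 1) (ht : 0 < t) :
    Integrable (Ksym ν t) := by
  have h : Integrable (fun k : ℝ × ℝ => (1 + ‖k‖) ^ (-3 : ℝ)) :=
    integrable_one_add_norm (by simp; norm_num)
  refine (h.const_mul (Real.exp (t / 2) * 6 / (t / 2) ^ 3)).mono'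
    (measurable_Ksym ν t).aestronglyMeasurable (.of_forall fun k => ?_)
  rw [Real.norm_of_nonneg (Ksym_pos ν t k).le]
  exact (Ksym_le_exp_neg_norm hν0 hν1 ht k).trans
    (exp_neg_mul_le (by positivity) (norm_nonneg k))

/-- The symbol modulated by the character of frequency `p`, on the Euclidean plane. -/
noncomputable def modulatedKsym (ν t : ℝ) (p : ℝ × ℝ) (v : WithLp 2 (ℝ × ℝ)) : ℂ :=
  (Ksym ν t v.ofLp : ℂ) *
    Complex.exp (Complex.I * ((v.ofLp.1 * p.1 + v.ofLp.2 * p.2 : ℝ) : ℂ))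

theorem measurable_modulatedKsym (ν t : ℝ) (p : ℝ × ℝ) : Measurable (modulatedKsym ν t p) := by
  have h := measurable_Ksym ν t
  unfold modulatedKsym
  fun_prop

theorem norm_modulatedKsym (ν t : ℝ) (p : ℝ × ℝ) (v : WithLp 2 (ℝ × ℝ)) :
    ‖modulatedKsym ν t p v‖ = Ksym ν t v.ofLp := by
  rw [modulatedKsym, norm_mul, mul_comm Complex.I, Complex.norm_exp_ofReal_mul_I, mul_one,
    Complex.norm_real, Real.norm_of_nonneg (Ksym_pos ν t _).le]

theorem integrable_Ksym_ofLp {ν t : ℝ} (hν0 : 0 ≤ ν) (hν1 : ν < 1) (ht : 0 < t) :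
    Integrable (fun v : WithLp 2 (ℝ × ℝ) => Ksym ν t v.ofLp) :=
  (WithLp.volume_preserving_ofLp ℝ ℝ).integrable_comp_of_integrable (integrable_Ksym hν0 hν1 ht)

theorem integrable_modulatedKsym {ν t : ℝ} (hν0 : 0 ≤ ν) (hν1 : ν < 1) (ht : 0 < t)
    (p : ℝ × ℝ) : Integrable (modulatedKsym ν t p) :=
  (integrable_Ksym_ofLp hν0 hν1 ht).mono' (measurable_modulatedKsym ν t p).aestronglyMeasurable
    (.of_forall fun v => (norm_modulatedKsym ν t p v).le)

theorem memLp_two_modulatedKsym {ν t : ℝ} (hν0 : 0 ≤ ν) (hν1 : ν < 1) (ht : 0 < t)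
    (p : ℝ × ℝ) : MemLp (modulatedKsym ν t p) 2 := by
  rw [memLp_two_iff_integrable_sq_norm (measurable_modulatedKsym ν t p).aestronglyMeasurable]
  simp_rw [norm_modulatedKsym, sq, Ksym_mul]
  exact integrable_Ksym_ofLp hν0 hν1 (by positivity)

theorem integral_withLp_prod (f : ℝ × ℝ → ℂ) :
    ∫ v : WithLp 2 (ℝ × ℝ), f v.ofLp = ∫ k, f k :=
  (WithLp.volume_preserving_ofLp ℝ ℝ).integral_comp
    (MeasurableEquiv.toLp 2 (ℝ × ℝ)).symm.measurableEmbedding f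

theorem fourier_modulatedKsym (ν t : ℝ) (p : ℝ × ℝ) (w : WithLp 2 (ℝ × ℝ)) :
    (1 / (2 * Real.pi) ^ 2 : ℂ) * 𝓕 (modulatedKsym ν t p) w =
      Kdis ν (p.1 - 2 * Real.pi * w.ofLp.1) (p.2 - 2 * Real.pi * w.ofLp.2) t := by
  rw [Kdis, ← integral_withLp_prod, Real.fourier_eq']
  congr 1
  apply integral_congr_ae (.of_forall fun v => ?_)
  simp only [modulatedKsym, smul_eq_mul, WithLp.prod_inner_apply, RCLike.inner_apply, conj_trivial]
  rw [mul_left_comm, ← Complex.exp_add]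
  congr 2
  push_cast
  ring

theorem conj_Kdis (ν x y t : ℝ) : conj (Kdis ν x y t) = Kdis ν (-x) (-y) t := by
  rw [Kdis, Kdis, map_mul, ← integral_conj]
  congr 1
  · simp [map_ofNat]
  · congr 1
    ext k
    rw [map_mul, Complex.conj_ofReal, ← Complex.exp_conj, map_mul, Complex.conj_I,
      Complex.conj_ofReal]
    congr 2
    push_cast
    ring

theorem kernel_semigroup (ν : ℝ) (hν0 : 0 ≤ ν) (hν1 : ν < 1) (s t : ℝ)
    (hs : 0 < s) (ht : 0 < t) (x y : ℝ) :
    (∫ q : ℝ × ℝ, Kdis ν (x - q.1) (y - q.2) s * Kdis ν q.1 q.2 t) =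
      Kdis ν x y (s + t) := by
  have hP := integral_conj_fourier_mul_fourier
    (integrable_modulatedKsym hν0 hν1 ht 0) (memLp_two_modulatedKsym hν0 hν1 ht 0)
    (integrable_modulatedKsym hν0 hν1 hs (x, y)) (memLp_two_modulatedKsym hν0 hν1 hs (x, y))
  set c : ℂ := 1 / (2 * Real.pi) ^ 2 with hc
  have hc_conj : conj c = c := by simp [hc, map_ofNat]
  have hleft : ∫ w, conj (𝓕 (modulatedKsym ν t 0) w) * 𝓕 (modulatedKsym ν s (x, y)) w =
      c⁻¹ ^ 2 * ∫ w : ℝ × ℝ, Kdis ν (x - ((2 * Real.pi) • w).1) (y - ((2 * Real.pi) • w).2) s *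
        Kdis ν ((2 * Real.pi) • w).1 ((2 * Real.pi) • w).2 t := by
    rw [← integral_withLp_prod, ← integral_const_mul]
    apply integral_congr_ae (.of_forall fun w => ?_)
    have h1 := fourier_modulatedKsym ν s (x, y) w
    have h2 := congrArg conj (fourier_modulatedKsym ν t 0 w)
    rw [conj_Kdis, map_mul, ← hc, hc_conj] at h2
    have hc0 : c ≠ 0 := by simp [hc, Real.pi_ne_zero]
    simp only [Prod.fst_zero, Prod.snd_zero, zero_sub, neg_neg] at h2
    simp only [Prod.smul_fst, Prod.smul_snd, smul_eq_mul]
    rw [← h1, ← h2, ← hc]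
    field_simp
  have hright : c * ∫ v, conj (modulatedKsym ν t 0 v) * modulatedKsym ν s (x, y) v =
      Kdis ν x y (s + t) := by
    rw [Kdis, ← integral_withLp_prod]
    congr 1
    apply integral_congr_ae (.of_forall fun v => ?_)
    simp only [modulatedKsym, Prod.fst_zero, Prod.snd_zero, mul_zero, add_zero,
      Complex.ofReal_zero, Complex.exp_zero, mul_one, Complex.conj_ofReal]
    rw [← Ksym_mul, Complex.ofReal_mul]
    ring
  rw [← hright, ← hP, hleft, Measure.integral_comp_smul volume
    (fun q : ℝ × ℝ => Kdis ν (x - q.1) (y - q.2) s * Kdis ν q.1 q.2 t)]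
  have hfr : Module.finrank ℝ (ℝ × ℝ) = 2 := by simp
  rw [hfr, abs_of_nonneg (by positivity), Complex.real_smul, hc]
  have hpi : (Real.pi : ℂ) ≠ 0 := by exact_mod_cast Real.pi_ne_zero
  push_cast
  field_simp
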